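/- For nonnegative reals (or elements of a commutative ring) t₁, t₂, …, and for n, x of the same parity, define M_x^n = Σ_{(i₁,…,i_x) ∈ A_x^n} t_{i₁} t_{i₂} ⋯ t_{i_x}. Then for all k ≥ 1 and 1 ≤ ℓ ≤ k the following identities hold: (a) M_{2ℓ+1}^{2k+1} = M_{2ℓ}^{2k} · t_{2k+1} + M_{2ℓ+1}^{2k−1}, and (b) M_{2ℓ}^{2k+2} = M_{2ℓ−1}^{2k+1} · t_{2k+2} + M_{2ℓ}^{2k}. -/

import Mathlib

/-- A finite set of naturals can be covered by disjoint 2-blocks: it is a disjoint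
union of blocks `{j, j+1}` of two consecutive positions. -/
def Pairable (S : Finset ℕ) : Prop :=
  ∃ P : Finset ℕ, (∀ j ∈ P, ∀ l ∈ P, j ≠ l → j + 2 ≤ l ∨ l + 2 ≤ j) ∧
    S = P.biUnion fun j => {j, j + 1}

open scoped Classical in
/-- `A_x^n`: the `x`-element subsets of `[n] = {1, …, n}` whose complement in `[n]`
can be partitioned into `(n−x)/2` disjoint 2-blocks. -/
noncomputable def markedSets (n x : ℕ) : Finset (Finset ℕ) :=
  (Finset.Icc 1 n).powerset.filter fun s =>
    s.card = x ∧ Pairable (Finset.Icc 1 n \ s)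

/-- `M_x^n = Σ_{(i₁,…,i_x) ∈ A_x^n} t_{i₁} ⋯ t_{i_x}`. -/
noncomputable def Msum {R : Type*} [CommRing R] (n x : ℕ) (t : ℕ → R) : R :=
  ∑ s ∈ markedSets n x, ∏ i ∈ s, t i

theorem Pairable.succ_mem_of_forall_le {S : Finset ℕ} {m : ℕ} (h : Pairable S)
    (hS : ∀ i ∈ S, i ≤ m + 1) (hm : m + 1 ∈ S) : m ∈ S := by
  obtain ⟨P, -, rfl⟩ := h
  obtain ⟨j, hj, hmj⟩ := Finset.mem_biUnion.1 hm
  have hle := hS (j + 1) (Finset.mem_biUnion.2 ⟨j, hj, by simp⟩)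
  have hjm : j = m := by
    simp only [Finset.mem_insert, Finset.mem_singleton] at hmj
    omega
  subst hjm
  exact Finset.mem_biUnion.2 ⟨j, hj, by simp⟩

theorem pairable_union_block_iff {S : Finset ℕ} {m : ℕ} (hS : ∀ i ∈ S, i < m) :
    Pairable (S ∪ {m, m + 1}) ↔ Pairable S := by
  constructor
  · rintro ⟨P, hP, h⟩
    have hmem : ∀ i, (i ∈ S ∨ i = m ∨ i = m + 1) ↔ ∃ j ∈ P, i = j ∨ i = j + 1 := by
      intro i
      have := Finset.ext_iff.1 h i
      simp only [Finset.mem_union, Finset.mem_biUnion, Finset.mem_insert,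
        Finset.mem_singleton] at this
      exact this
    have hPm : ∀ j ∈ P, j ≤ m := by
      intro j hj
      have := (hmem (j + 1)).2 ⟨j, hj, Or.inr rfl⟩
      have := hS (j + 1)
      grind
    have hm : m ∈ P := by
      obtain ⟨j, hj, h'⟩ := (hmem (m + 1)).1 (by simp)
      have := hPm j hj
      grind
    refine ⟨P.erase m, fun j hj l hl => hP j (Finset.mem_of_mem_erase hj) l
      (Finset.mem_of_mem_erase hl), ?_⟩
    ext i
    simp only [Finset.mem_biUnion, Finset.mem_erase, Finset.mem_insert, Finset.mem_singleton]
    constructor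
    · intro hi
      obtain ⟨j, hj, h'⟩ := (hmem i).1 (Or.inl hi)
      have := hS i hi
      exact ⟨j, ⟨by omega, hj⟩, h'⟩
    · rintro ⟨j, ⟨hjm, hj⟩, h'⟩
      have := hP j hj m hm hjm
      have := hPm j hj
      rcases (hmem i).2 ⟨j, hj, h'⟩ with hi | hi
      · exact hi
      · omega
  · rintro ⟨P, hP, rfl⟩
    have hPm : ∀ j ∈ P, j + 1 < m := fun j hj =>
      hS (j + 1) (Finset.mem_biUnion.2 ⟨j, hj, by simp⟩)
    refine ⟨insert m P, ?_, ?_⟩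
    · intro j hj l hl hjl
      rcases Finset.mem_insert.1 hj with hj | hj <;> rcases Finset.mem_insert.1 hl with hl | hl
      · exact absurd (hj.trans hl.symm) hjl
      · exact Or.inr (hj ▸ hPm l hl)
      · exact Or.inl (hl ▸ hPm j hj)
      · exact hP j hj l hl hjl
    · rw [Finset.biUnion_insert, Finset.union_comm]

theorem mem_markedSets {n x : ℕ} {s : Finset ℕ} :
    s ∈ markedSets n x ↔
      s ⊆ Finset.Icc 1 n ∧ s.card = x ∧ Pairable (Finset.Icc 1 n \ s) := by
  simp [markedSets]

theorem notMem_of_mem_markedSets {n x i : ℕ} {s : Finset ℕ} (hs : s ∈ markedSets n x)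
    (hi : n < i) : i ∉ s := fun h => by
  have := Finset.mem_Icc.1 ((mem_markedSets.1 hs).1 h)
  omega

theorem insert_mem_markedSets_succ_iff {n x : ℕ} {s : Finset ℕ} (hs : n + 1 ∉ s) :
    insert (n + 1) s ∈ markedSets (n + 1) (x + 1) ↔ s ∈ markedSets n x := by
  have hsub : insert (n + 1) s ⊆ Finset.Icc 1 (n + 1) ↔ s ⊆ Finset.Icc 1 n := by
    constructor <;> intro h i hi
    · have := Finset.mem_Icc.1 (h (Finset.mem_insert_of_mem hi))
      have : i ≠ n + 1 := fun h' => hs (h' ▸ hi)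
      exact Finset.mem_Icc.2 (by omega)
    · rcases Finset.mem_insert.1 hi with rfl | hi
      · simp
      · have := Finset.mem_Icc.1 (h hi)
        exact Finset.mem_Icc.2 (by omega)
  have hsdiff : Finset.Icc 1 (n + 1) \ insert (n + 1) s = Finset.Icc 1 n \ s := by
    ext i
    simp only [Finset.mem_sdiff, Finset.mem_Icc, Finset.mem_insert]
    grind
  rw [mem_markedSets, mem_markedSets, hsub, hsdiff, Finset.card_insert_of_notMem hs,
    Nat.add_right_cancel_iff]

theorem mem_markedSets_add_two_iff {n x : ℕ} {s : Finset ℕ} (hs : n + 2 ∉ s) :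
    s ∈ markedSets (n + 2) x ↔ s ∈ markedSets n x := by
  have key (h : s ⊆ Finset.Icc 1 n) :
      Pairable (Finset.Icc 1 (n + 2) \ s) ↔ Pairable (Finset.Icc 1 n \ s) := by
    have heq : Finset.Icc 1 (n + 2) \ s = (Finset.Icc 1 n \ s) ∪ {n + 1, n + 1 + 1} := by
      ext i
      have := @h i
      simp only [Finset.mem_sdiff, Finset.mem_Icc, Finset.mem_union, Finset.mem_insert,
        Finset.mem_singleton] at this ⊢
      grind
    rw [heq]
    refine pairable_union_block_iff fun i hi => ?_
    have := Finset.mem_Icc.1 (Finset.mem_sdiff.1 hi).1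
    omega
  rw [mem_markedSets, mem_markedSets]
  constructor
  · rintro ⟨hsub, hcard, hpair⟩
    have hn : n + 1 ∉ s := by
      have := hpair.succ_mem_of_forall_le (m := n + 1)
        (fun i hi => (Finset.mem_Icc.1 (Finset.mem_sdiff.1 hi).1).2) (by simp [hs])
      exact (Finset.mem_sdiff.1 this).2
    have hsub' : s ⊆ Finset.Icc 1 n := by
      intro i hi
      have := Finset.mem_Icc.1 (hsub hi)
      have : i ≠ n + 1 := fun h => hn (h ▸ hi)
      have : i ≠ n + 2 := fun h => hs (h ▸ hi)
      exact Finset.mem_Icc.2 (by omega)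
    exact ⟨hsub', hcard, (key hsub').1 hpair⟩
  · rintro ⟨hsub, hcard, hpair⟩
    exact ⟨hsub.trans (Finset.Icc_subset_Icc_right (by omega)), hcard, (key hsub).2 hpair⟩

theorem markedSets_add_two (n x : ℕ) :
    markedSets (n + 2) (x + 1) =
      (markedSets (n + 1) x).image (insert (n + 2)) ∪ markedSets n (x + 1) := by
  ext s
  rw [Finset.mem_union, Finset.mem_image]
  constructor
  · intro h
    by_cases hs : n + 2 ∈ s
    · refine Or.inl ⟨s.erase (n + 2), ?_, Finset.insert_erase hs⟩
      rw [← insert_mem_markedSets_succ_iff (Finset.notMem_erase _ _), Finset.insert_erase hs]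
      exact h
    · exact Or.inr ((mem_markedSets_add_two_iff hs).1 h)
  · rintro (⟨u, hu, rfl⟩ | h)
    · exact (insert_mem_markedSets_succ_iff (notMem_of_mem_markedSets hu (by omega))).2 hu
    · exact (mem_markedSets_add_two_iff (notMem_of_mem_markedSets h (by omega))).2 h

theorem Msum_add_two {R : Type*} [CommRing R] (t : ℕ → R) (n x : ℕ) :
    Msum (n + 2) (x + 1) t = Msum (n + 1) x t * t (n + 2) + Msum n (x + 1) t := by
  have hnot : ∀ u ∈ markedSets (n + 1) x, n + 2 ∉ u := fun u hu =>
    notMem_of_mem_markedSets hu (by omega)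
  have hdisj : Disjoint ((markedSets (n + 1) x).image (insert (n + 2)))
      (markedSets n (x + 1)) := by
    rw [Finset.disjoint_left]
    intro s hs hs'
    obtain ⟨u, -, rfl⟩ := Finset.mem_image.1 hs
    exact notMem_of_mem_markedSets hs' (by omega) (Finset.mem_insert_self (n + 2) u)
  have hinj : Set.InjOn (insert (n + 2)) (markedSets (n + 1) x : Set (Finset ℕ)) := by
    intro u hu v hv huv
    rw [← Finset.erase_insert (hnot u hu), huv, Finset.erase_insert (hnot v hv)]
  unfold Msum
  rw [markedSets_add_two, Finset.sum_union hdisj, Finset.sum_image hinj, Finset.sum_mul]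
  congr 1
  refine Finset.sum_congr rfl fun u hu => ?_
  rw [Finset.prod_insert (hnot u hu), mul_comm]

/-- For `k ≥ 1` and `1 ≤ ℓ ≤ k`:
(a) `M_{2ℓ+1}^{2k+1} = M_{2ℓ}^{2k}·t_{2k+1} + M_{2ℓ+1}^{2k−1}`, and
(b) `M_{2ℓ}^{2k+2} = M_{2ℓ−1}^{2k+1}·t_{2k+2} + M_{2ℓ}^{2k}`. -/
theorem Msum_recursion {R : Type*} [CommRing R] (t : ℕ → R) (k ℓ : ℕ)
    (hk : 1 ≤ k) (hl1 : 1 ≤ ℓ) (hlk : ℓ ≤ k) :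
    Msum (2 * k + 1) (2 * ℓ + 1) t
        = Msum (2 * k) (2 * ℓ) t * t (2 * k + 1) + Msum (2 * k - 1) (2 * ℓ + 1) t ∧
      Msum (2 * k + 2) (2 * ℓ) t
        = Msum (2 * k + 1) (2 * ℓ - 1) t * t (2 * k + 2) + Msum (2 * k) (2 * ℓ) t := by
  obtain ⟨k, rfl⟩ := Nat.exists_eq_add_of_le' hk
  obtain ⟨l, rfl⟩ := Nat.exists_eq_add_of_le' hl1
  exact ⟨Msum_add_two t (2 * k + 1) (2 * (l + 1)), Msum_add_two t (2 * (k + 1)) (2 * l + 1)⟩
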